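/- Let Γ be a nonempty set of measurable functions on X with α ≤ h ≤ β for all h ∈ Γ (α < β), admitting a countable subset Γ₀ ⊂ Γ such that every h ∈ Γ is a pointwise limit of a sequence from Γ₀. Let 0 ≤ a < 1 < b ≤ ∞ and f ∈ F₁(a,b) be strictly convex in a neighborhood of 1 with z₀ + β − α in the interior of {f* < ∞}, where z₀ := f'_+(1). Let Q, P be probability measures on X, let X₁,…,X_n ~ Q and X'₁,…,X'_m ~ P be jointly independent samples, with empirical measures Q_n, P_m. Then for every ε > 0: ℙ( D_f^Γ(Q‖P) − D_f^Γ(Q_n‖P_m) ≥ ε ) ≤ exp( −2ε² / ( (1/n)(β−α)² + (1/m) Δ_{f,m}² ) ). -/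

import Mathlib

open MeasureTheory Set Filter Topology
open scoped ENNReal NNReal Classical

noncomputable section

/-- The interval `(a, b)` with `b` possibly infinite. -/
def Dom (a : ℝ) (b : EReal) : Set ℝ := {t : ℝ | a < t ∧ (t : EReal) < b}

/-- Legendre transform of `f` on `(a,b)`, with values in `(-∞, ∞]` (modeled by `EReal`). -/
def fStar (f : ℝ → ℝ) (a : ℝ) (b : EReal) (z : ℝ) : EReal :=
  ⨆ t ∈ Dom a b, ((z * t - f t : ℝ) : EReal)

/-- Real-valued version of the Legendre transform (junk value where it is `⊤`). -/
def fStarR (f : ℝ → ℝ) (a : ℝ) (b : EReal) (z : ℝ) : ℝ := (fStar f a b z).toReal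

/-- Right derivative of `g` at `z`. -/
def rderiv (g : ℝ → ℝ) (z : ℝ) : ℝ := derivWithin g (Ici z) z

/-- `z₀ := f'_+(1)`. -/
def zz (f : ℝ → ℝ) : ℝ := rderiv f 1

/-- Integral of an `EReal`-valued function: the Bochner integral if the function is
a.e. finite and integrable, and `⊤` otherwise. -/
def eIntegral {X : Type*} [MeasurableSpace X] (P : Measure X) (g : X → EReal) : EReal :=
  if (∀ᵐ x ∂P, g x ≠ ⊤) ∧ Integrable (fun x => (g x).toReal) P
  then ((∫ x, (g x).toReal ∂P : ℝ) : EReal) else ⊤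

/-- The generalized cumulant generating function `Λ_f^P[h]`. -/
def cgf {X : Type*} [MeasurableSpace X] (f : ℝ → ℝ) (a : ℝ) (b : EReal)
    (P : Measure X) (h : X → ℝ) : EReal :=
  ⨅ ν : ℝ, ((ν : EReal) + eIntegral P (fun x => fStar f a b (h x - ν)))

/-- Real-valued `Λ_f^P[h]`. -/
def cgfR {X : Type*} [MeasurableSpace X] (f : ℝ → ℝ) (a : ℝ) (b : EReal)
    (P : Measure X) (h : X → ℝ) : ℝ := (cgf f a b P h).toReal

/-- `Λ_f : ℝⁿ → ℝ` (with values in `EReal`). -/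
def lamVec (f : ℝ → ℝ) (a : ℝ) (b : EReal) {n : ℕ} (x : Fin n → ℝ) : EReal :=
  ⨅ ν : ℝ, ((ν : EReal) + ((n : ℝ)⁻¹ : EReal) * ∑ i, fStar f a b (x i - ν))

/-- Empirical measure of `n` points. -/
def empMeas {X : Type*} [MeasurableSpace X] (n : ℕ) (xs : Fin n → X) : Measure X :=
  (n : ℝ≥0∞)⁻¹ • ∑ i, Measure.dirac (xs i)

/-- The `(f,Γ)`-divergence `D_f^Γ(Q‖P)`. -/
def Dfg {X : Type*} [MeasurableSpace X] (f : ℝ → ℝ) (a : ℝ) (b : EReal)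
    (Γ : Set (X → ℝ)) (Q P : Measure X) : ℝ :=
  sSup {r : ℝ | ∃ h ∈ Γ, r = ∫ x, h x ∂Q - cgfR f a b P h}

/-- Empirical Rademacher complexity of `Ψ` at the sample `y`. -/
def empRad {Y : Type*} (Ψ : Set (Y → ℝ)) (n : ℕ) (y : Fin n → Y) : ℝ :=
  (2 ^ n : ℝ)⁻¹ * ∑ σ : Fin n → Bool,
    sSup {r : ℝ | ∃ ψ ∈ Ψ, r = (n : ℝ)⁻¹ * ∑ i, (if σ i then 1 else -1) * ψ (y i)}

/-- Rademacher complexity of `Ψ` relative to `P` with `n` samples. -/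
def rad {Y : Type*} [MeasurableSpace Y] (Ψ : Set (Y → ℝ)) (P : Measure Y) (n : ℕ) : ℝ :=
  ∫ y, empRad Ψ n y ∂(Measure.pi fun _ : Fin n => P)

/-- `Δ_{f,n}`. -/
def Δq (f : ℝ → ℝ) (a : ℝ) (b : EReal) (α β : ℝ) (n : ℕ) : ℝ :=
  sInf ((fun z => (n : ℝ) * (-z + (((n : ℝ) - 1) / (n : ℝ)) * fStarR f a b z
      + (1 / (n : ℝ)) * fStarR f a b (β - α + z))) '' Icc (zz f - (β - α)) (zz f))

/-- `sup_{h ∈ Γ} inf_{h̃ ∈ Γ̃} ‖h − h̃‖_∞`. -/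
def approxErr {X : Type*} (Γ Γt : Set (X → ℝ)) : ℝ :=
  sSup {r : ℝ | ∃ h ∈ Γ, r = sInf {s : ℝ | ∃ ht ∈ Γt, s = ⨆ x, |h x - ht x|}}

/-- A countable subset which is pointwise-limit dense. -/
def PtwiseDenseCount {X : Type*} (Γ : Set (X → ℝ)) : Prop :=
  ∃ Γ₀ ⊆ Γ, Γ₀.Countable ∧ ∀ h ∈ Γ, ∃ s : ℕ → X → ℝ,
    (∀ j, s j ∈ Γ₀) ∧ ∀ x, Tendsto (fun j => s j x) atTop (𝓝 (h x))

/-- The quantity `K_{f,Ψ,P,n}` from Definition 3.4: either `(f*)'_+` is Lipschitz on the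
relevant interval and `Ψ` contains a constant, in which case `K` is the minimum of the two
expressions, or `K` is the second expression. -/
def Kchoice (f : ℝ → ℝ) (a : ℝ) (b : EReal) (α β : ℝ) {Y : Type*} [MeasurableSpace Y]
    (Ψ : Set (Y → ℝ)) (P : Measure Y) (n : ℕ) (K : ℝ) : Prop :=
  (∃ L : ℝ≥0, LipschitzOnWith L (rderiv (fStarR f a b))
      (Icc (zz f - (β - α)) (zz f + (β - α))) ∧
    (∃ c : ℝ, (fun _ => c) ∈ Ψ) ∧
    K = min ((1 + 2 * (β - α) * (L : ℝ)) * rad Ψ P n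
        + (β - α) ^ 2 * (L : ℝ) / (2 * Real.sqrt n))
      (rderiv (fStarR f a b) (β - α + zz f) * (rad Ψ P n + (β - α) / (2 * Real.sqrt n))))
  ∨ K = rderiv (fStarR f a b) (β - α + zz f) * (rad Ψ P n + (β - α) / (2 * Real.sqrt n))

/-- Covering number of a (pseudo)metric space by `ε`-balls. -/
def coverNum (Θ : Type*) [PseudoMetricSpace Θ] (ε : ℝ) : ℝ≥0∞ :=
  ⨅ s ∈ {s : Finset Θ | ∀ θ : Θ, ∃ c ∈ s, dist θ c ≤ ε}, ((s.card : ℝ≥0∞))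

end


section BoundedDifferences

open ProbabilityTheory

/-- Two-step bound: a bounded function on a product is sub-Gaussian about its mean if its sections
are sub-Gaussian about their means and these means are sub-Gaussian about the overall mean. -/
lemma hasSubgaussianMGF_prod {A B : Type*} [MeasurableSpace A] [MeasurableSpace B]
    {μ : Measure A} {ν : Measure B} [IsProbabilityMeasure μ] [IsProbabilityMeasure ν]
    {G : A × B → ℝ} (hG : Measurable G) {C : ℝ} (hC : ∀ p, |G p| ≤ C) {c d : ℝ≥0}
    (hc : ∀ y, HasSubgaussianMGF (fun x => G (x, y) - ∫ x', G (x', y) ∂μ) c μ)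
    (hd : HasSubgaussianMGF (fun y => (∫ x, G (x, y) ∂μ) - ∫ p, G p ∂(μ.prod ν)) d ν) :
    HasSubgaussianMGF (fun p => G p - ∫ p', G p' ∂(μ.prod ν)) (c + d) (μ.prod ν) := by
  set E := ∫ p, G p ∂(μ.prod ν)
  have h_int : ∀ t : ℝ, Integrable (fun p => Real.exp (t * (G p - E))) (μ.prod ν) := by
    intro t
    refine Integrable.of_bound (by fun_prop) (Real.exp (|t| * (C + |E|))) (ae_of_all _ fun p => ?_)
    rw [Real.norm_eq_abs, Real.abs_exp]
    refine Real.exp_le_exp.2 ((le_abs_self _).trans ?_)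
    rw [abs_mul]
    gcongr
    exact (abs_sub _ _).trans (by gcongr; exact hC p)
  refine ⟨h_int, fun t => ?_⟩
  calc mgf (fun p => G p - E) (μ.prod ν) t
      = ∫ y, ∫ x, Real.exp (t * (G (x, y) - E)) ∂μ ∂ν := integral_prod_symm _ (h_int t)
    _ ≤ ∫ y, Real.exp (c * t ^ 2 / 2) * Real.exp (t * ((∫ x, G (x, y) ∂μ) - E)) ∂ν := by
      refine integral_mono (h_int t).integral_prod_right
        ((hd.integrable_exp_mul t).const_mul _) fun y => ?_
      have h1 : ∀ x, Real.exp (t * (G (x, y) - E))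
          = Real.exp (t * (G (x, y) - ∫ x', G (x', y) ∂μ))
            * Real.exp (t * ((∫ x, G (x, y) ∂μ) - E)) := by
        intro x
        rw [← Real.exp_add]
        ring_nf
      simp only [h1]
      rw [integral_mul_const]
      gcongr
      exact (hc y).mgf_le t
    _ = Real.exp (c * t ^ 2 / 2) * mgf (fun y => (∫ x, G (x, y) ∂μ) - E) ν t := by
      rw [integral_const_mul]; rfl
    _ ≤ Real.exp (c * t ^ 2 / 2) * Real.exp (d * t ^ 2 / 2) := by
      gcongr
      exact hd.mgf_le t
    _ = Real.exp (((c + d : ℝ≥0) : ℝ) * t ^ 2 / 2) := by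
      rw [← Real.exp_add]
      push_cast
      ring_nf

/-- **McDiarmid's inequality** in moment generating function form: a bounded function of `k` i.i.d.
variables which moves by at most `c` when one variable is changed is sub-Gaussian about its mean. -/
lemma hasSubgaussianMGF_of_bounded_differences {X : Type*} [MeasurableSpace X]
    (μ : Measure X) [IsProbabilityMeasure μ] {c : ℝ} (C : ℝ) (k : ℕ) (F : (Fin k → X) → ℝ)
    (hF : Measurable F) (hC : ∀ x, |F x| ≤ C)
    (hc : ∀ i x y, (∀ j, j ≠ i → x j = y j) → F x - F y ≤ c) :
    HasSubgaussianMGF (fun x => F x - ∫ y, F y ∂(Measure.pi fun _ : Fin k => μ))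
      (k * (‖c‖₊ / 2) ^ 2) (Measure.pi fun _ : Fin k => μ) := by
  induction k with
  | zero =>
    have h0 : ∀ x y : Fin 0 → X, F x = F y := fun x y => congrArg F (Subsingleton.elim _ _)
    have h1 : (fun x => F x - ∫ y, F y ∂(Measure.pi fun _ : Fin 0 => μ)) = fun _ => 0 := by
      funext x
      simp [h0 _ x]
    rw [h1]
    simp
  | succ k ih =>
    set e := MeasurableEquiv.piFinSuccAbove (fun _ : Fin (k + 1) => X) 0 with he
    have hmp := measurePreserving_piFinSuccAbove (fun _ : Fin (k + 1) => μ) 0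
    set G : X × (Fin k → X) → ℝ := fun p => F (Fin.cons p.1 p.2) with hGdef
    have hFG : ∀ x, F x = G (e x) := by
      intro x
      simp [hGdef, he, MeasurableEquiv.piFinSuccAbove]
    have hGF : G = F ∘ e.symm := by
      funext p
      simp [hFG]
    have hG : Measurable G := hGF ▸ hF.comp e.symm.measurable
    have hGC : ∀ p, |G p| ≤ C := fun p => hC _
    have hsec : ∀ y, Measurable fun x => G (x, y) := fun y => by fun_prop
    have h_int : ∀ y, Integrable (fun x => G (x, y)) μ := fun y =>
      Integrable.of_bound (hsec y).aestronglyMeasurable C (ae_of_all _ fun x => hGC _)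
    have hdiff : ∀ x x' y, G (x, y) - G (x', y) ≤ c := by
      intro x x' y
      refine hc 0 _ _ fun j hj => ?_
      obtain ⟨i, rfl⟩ := Fin.exists_succ_eq.2 hj
      simp
    have h1 : ∀ y, HasSubgaussianMGF (fun x => G (x, y) - ∫ x', G (x', y) ∂μ)
        ((‖c‖₊ / 2) ^ 2) μ := by
      intro y
      have hbdd : BddBelow (range fun x => G (x, y)) :=
        ⟨-C, by rintro _ ⟨x, rfl⟩; exact (abs_le.1 (hGC _)).1⟩
      have := hasSubgaussianMGF_of_mem_Icc (μ := μ) (X := fun x => G (x, y))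
        (a := ⨅ x, G (x, y)) (b := (⨅ x, G (x, y)) + c) (hsec y).aemeasurable
        (ae_of_all _ fun x => ⟨ciInf_le hbdd x, by
          have : Nonempty X := ⟨x⟩
          have : G (x, y) - c ≤ ⨅ x, G (x, y) :=
            le_ciInf fun x' => by linarith [hdiff x x' y]
          linarith⟩)
      simpa using this
    have h2 := ih (fun y => ∫ x, G (x, y) ∂μ)
      (hG.stronglyMeasurable.integral_prod_left').measurable
      (fun y => by
        simpa using norm_integral_le_of_norm_le_const (μ := μ) (f := fun x => G (x, y)) (C := C)
          (ae_of_all _ fun x => hGC _))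
      (fun i y y' hyy => by
        rw [← integral_sub (h_int y) (h_int y')]
        calc ∫ x, (G (x, y) - G (x, y')) ∂μ ≤ ∫ _, c ∂μ := by
              refine integral_mono ((h_int y).sub (h_int y')) (integrable_const _) fun x => ?_
              refine hc i.succ _ _ fun j hj => ?_
              refine Fin.cases (by simp) (fun j hj => ?_) j hj
              simpa using hyy j (fun h => hj (by rw [h]))
          _ = c := by simp)
    have hGint : Integrable G (μ.prod (Measure.pi fun _ : Fin k => μ)) :=
      Integrable.of_bound hG.aestronglyMeasurable C (ae_of_all _ fun x => hGC _)
    rw [← integral_prod_symm _ hGint] at h2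
    have h3 := hasSubgaussianMGF_prod hG hGC h1 h2
    have hE : ∫ y, F y ∂(Measure.pi fun _ : Fin (k + 1) => μ)
        = ∫ p, G p ∂(μ.prod (Measure.pi fun _ : Fin k => μ)) := by
      simp only [hFG]
      exact hmp.integral_comp' G
    rw [hE]
    simp only [hFG]
    rw [← hmp.map_eq] at h3
    have h4 := HasSubgaussianMGF.of_map e.measurable.aemeasurable h3
    have hk : (((k + 1 : ℕ) : ℝ≥0) * (‖c‖₊ / 2) ^ 2)
        = (‖c‖₊ / 2) ^ 2 + k * (‖c‖₊ / 2) ^ 2 := by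
      push_cast; ring
    rw [hk]
    convert h4 using 1
    funext x
    simp only [Function.comp, hmp.map_eq]

end BoundedDifferences

section LegendreTransform

variable {f : ℝ → ℝ} {a : ℝ} {b : EReal}

lemma le_fStar (ha1 : a < 1) (hb1 : ((1 : ℝ) : EReal) < b) (hf1 : f 1 = 0) (z : ℝ) :
    (z : EReal) ≤ fStar f a b z :=
  le_iSup₂_of_le (f := fun t (_ : t ∈ Dom a b) => ((z * t - f t : ℝ) : EReal)) 1 ⟨ha1, hb1⟩
    (by simp [hf1])

lemma fStar_mono (ha0 : 0 ≤ a) : Monotone (fStar f a b) := by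
  intro z w hzw
  refine iSup₂_mono fun t ht => EReal.coe_le_coe_iff.2 ?_
  have : 0 ≤ t := ha0.trans ht.1.le
  gcongr

lemma coe_fStarR (ha1 : a < 1) (hb1 : ((1 : ℝ) : EReal) < b) (hf1 : f 1 = 0) {z : ℝ}
    (hz : fStar f a b z ≠ ⊤) : ((fStarR f a b z : ℝ) : EReal) = fStar f a b z :=
  EReal.coe_toReal hz fun h => by simpa [h] using le_fStar ha1 hb1 hf1 z

lemma fStar_ne_top_of_le (ha0 : 0 ≤ a) {z w : ℝ} (hzw : z ≤ w) (hw : fStar f a b w ≠ ⊤) :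
    fStar f a b z ≠ ⊤ :=
  ne_top_of_le_ne_top hw (fStar_mono ha0 hzw)

lemma le_fStarR (ha1 : a < 1) (hb1 : ((1 : ℝ) : EReal) < b) (hf1 : f 1 = 0) {z : ℝ}
    (hz : fStar f a b z ≠ ⊤) : z ≤ fStarR f a b z := by
  rw [← EReal.coe_le_coe_iff, coe_fStarR ha1 hb1 hf1 hz]
  exact le_fStar ha1 hb1 hf1 z

lemma fStarR_le_fStarR (ha0 : 0 ≤ a) (ha1 : a < 1) (hb1 : ((1 : ℝ) : EReal) < b) (hf1 : f 1 = 0)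
    {z w : ℝ} (hzw : z ≤ w) (hw : fStar f a b w ≠ ⊤) : fStarR f a b z ≤ fStarR f a b w := by
  rw [← EReal.coe_le_coe_iff, coe_fStarR ha1 hb1 hf1 hw,
    coe_fStarR ha1 hb1 hf1 (fStar_ne_top_of_le ha0 hzw hw)]
  exact fStar_mono ha0 hzw

lemma mul_sub_le_fStarR (ha1 : a < 1) (hb1 : ((1 : ℝ) : EReal) < b) (hf1 : f 1 = 0)
    {z t : ℝ} (hz : fStar f a b z ≠ ⊤) (ht : t ∈ Dom a b) : z * t - f t ≤ fStarR f a b z := by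
  rw [← EReal.coe_le_coe_iff, coe_fStarR ha1 hb1 hf1 hz]
  exact le_iSup₂ (f := fun t (_ : t ∈ Dom a b) => ((z * t - f t : ℝ) : EReal)) t ht

lemma fStarR_le (ha1 : a < 1) (hb1 : ((1 : ℝ) : EReal) < b) (hf1 : f 1 = 0)
    {z r : ℝ} (hz : fStar f a b z ≠ ⊤) (hr : ∀ t ∈ Dom a b, z * t - f t ≤ r) :
    fStarR f a b z ≤ r := by
  rw [← EReal.coe_le_coe_iff, coe_fStarR ha1 hb1 hf1 hz]
  exact iSup₂_le fun t ht => EReal.coe_le_coe_iff.2 (hr t ht)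

/-- Increments of `f*` over steps of a fixed length are nondecreasing. -/
lemma fStarR_add_le (ha0 : 0 ≤ a) (ha1 : a < 1) (hb1 : ((1 : ℝ) : EReal) < b) (hf1 : f 1 = 0)
    {p q d : ℝ} (hpq : p ≤ q) (hd : 0 ≤ d) (hz : fStar f a b (q + d) ≠ ⊤) :
    fStarR f a b (p + d) + fStarR f a b q ≤ fStarR f a b p + fStarR f a b (q + d) := by
  have hp := fStar_ne_top_of_le ha0 (by linarith : p ≤ q + d) hz
  have hq := fStar_ne_top_of_le ha0 (by linarith : q ≤ q + d) hz
  have hpd := fStar_ne_top_of_le ha0 (by linarith : p + d ≤ q + d) hz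
  rw [← le_sub_iff_add_le]
  refine fStarR_le ha1 hb1 hf1 hpd fun t ht => ?_
  rw [le_sub_iff_add_le, add_comm, ← le_sub_iff_add_le]
  refine fStarR_le ha1 hb1 hf1 hq fun s hs => ?_
  rcases le_total t s with hts | hst
  · have h1 := mul_sub_le_fStarR ha1 hb1 hf1 hp ht
    have h2 := mul_sub_le_fStarR ha1 hb1 hf1 hz hs
    nlinarith [mul_nonneg hd (sub_nonneg.2 hts)]
  · have h1 := mul_sub_le_fStarR ha1 hb1 hf1 hp hs
    have h2 := mul_sub_le_fStarR ha1 hb1 hf1 hz ht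
    nlinarith [mul_nonneg (sub_nonneg.2 hpq) (sub_nonneg.2 hst)]

lemma measurable_fStar (ha0 : 0 ≤ a) : Measurable (fStar f a b) := (fStar_mono ha0).measurable

lemma measurable_fStarR (ha0 : 0 ≤ a) : Measurable (fStarR f a b) :=
  (measurable_fStar ha0).ereal_toReal

end LegendreTransform

section EmpiricalMeasure

variable {X : Type*} [MeasurableSpace X]

lemma isProbabilityMeasure_empMeas {n : ℕ} (hn : 0 < n) (xs : Fin n → X) :
    IsProbabilityMeasure (empMeas n xs) := by
  refine ⟨?_⟩
  simp only [empMeas, Measure.smul_apply, Measure.finsetSum_apply, measure_univ, smul_eq_mul]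
  simpa using ENNReal.inv_mul_cancel (by exact_mod_cast hn.ne') (ENNReal.natCast_ne_top n)

lemma integrable_sum_dirac {n : ℕ} (xs : Fin n → X) {g : X → ℝ} (hg : Measurable g) :
    ∀ i ∈ Finset.univ, Integrable g (Measure.dirac (xs i)) := fun _ _ =>
  integrable_dirac' hg.stronglyMeasurable (by simp)

lemma integrable_empMeas {n : ℕ} (hn : 0 < n) (xs : Fin n → X) {g : X → ℝ} (hg : Measurable g) :
    Integrable g (empMeas n xs) :=
  (integrable_finsetSum_measure.2 (integrable_sum_dirac xs hg)).smul_measure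
    (ENNReal.inv_ne_top.2 (by exact_mod_cast hn.ne'))

lemma integral_empMeas {n : ℕ} (xs : Fin n → X) {g : X → ℝ} (hg : Measurable g) :
    ∫ x, g x ∂(empMeas n xs) = (n : ℝ)⁻¹ * ∑ i, g (xs i) := by
  rw [empMeas, integral_smul_measure, integral_finsetSum_measure (integrable_sum_dirac xs hg)]
  simp [integral_dirac' _ _ hg.stronglyMeasurable]

lemma ae_empMeas_iff {n : ℕ} (xs : Fin n → X) {p : X → Prop} (hp : MeasurableSet {x | p x}) :
    (∀ᵐ x ∂(empMeas n xs), p x) ↔ ∀ i, p (xs i) := by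
  rw [ae_iff, empMeas]
  have hp' : MeasurableSet {x | ¬ p x} := hp.compl
  simp [Measure.dirac_apply' _ hp', indicator_apply]

end EmpiricalMeasure

section Cumulant

variable {f : ℝ → ℝ} {a : ℝ} {b : EReal}

lemma toReal_iInf_add_ite {p : ℝ → Prop} [DecidablePred p] {w : ℝ → ℝ} {l : ℝ} (hp : ∃ ν, p ν)
    (hl : ∀ ν, p ν → l ≤ ν + w ν) :
    (⨅ ν : ℝ, ((ν : EReal) + if p ν then (w ν : EReal) else ⊤)).toReal
      = sInf {r | ∃ ν, p ν ∧ r = ν + w ν} := by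
  set S := {r | ∃ ν, p ν ∧ r = ν + w ν}
  have hb : BddBelow S := ⟨l, by rintro _ ⟨ν, hν, rfl⟩; exact hl ν hν⟩
  have hne : S.Nonempty := let ⟨ν, hν⟩ := hp; ⟨_, ν, hν, rfl⟩
  have h1 : ((sInf S : ℝ) : EReal) ≤ ⨅ ν : ℝ, ((ν : EReal) + if p ν then (w ν : EReal) else ⊤) := by
    refine le_iInf fun ν => ?_
    split_ifs with h
    · exact_mod_cast csInf_le hb ⟨ν, h, rfl⟩
    · simp
  have h2 : ∀ r ∈ S, (⨅ ν : ℝ, ((ν : EReal) + if p ν then (w ν : EReal) else ⊤)) ≤ (r : EReal) := by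
    rintro _ ⟨ν, hν, rfl⟩
    exact iInf_le_of_le ν (by simp [hν])
  generalize (⨅ ν : ℝ, ((ν : EReal) + if p ν then (w ν : EReal) else ⊤)) = I at h1 h2
  induction I with
  | bot => simp at h1
  | top => obtain ⟨r, hr⟩ := hne; simpa using h2 r hr
  | coe i =>
    rw [EReal.toReal_coe]
    exact le_antisymm (le_csInf hne fun r hr => EReal.coe_le_coe_iff.1 (h2 r hr))
      (EReal.coe_le_coe_iff.1 h1)

/-- The real values taken by the objective in the definition of `Λ_f^P[h]`. -/
def cgfValues {X : Type*} [MeasurableSpace X] (f : ℝ → ℝ) (a : ℝ) (b : EReal) (P : Measure X)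
    (h : X → ℝ) : Set ℝ :=
  {r | ∃ ν : ℝ, ((∀ᵐ x ∂P, fStar f a b (h x - ν) ≠ ⊤) ∧
    Integrable (fun x => fStarR f a b (h x - ν)) P) ∧ r = ν + ∫ x, fStarR f a b (h x - ν) ∂P}

section

variable {X : Type*} [MeasurableSpace X] {P : Measure X} [IsProbabilityMeasure P]
  {h : X → ℝ} {α β z₁ : ℝ}

lemma cgfValues_nonempty (ha0 : 0 ≤ a) (ha1 : a < 1) (hb1 : ((1 : ℝ) : EReal) < b) (hf1 : f 1 = 0)
    (hh : Measurable h) (hb : ∀ x, h x ∈ Icc α β) (hz : fStar f a b z₁ ≠ ⊤) :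
    (cgfValues f a b P h).Nonempty := by
  have hle : ∀ x, h x - (β - z₁) ≤ z₁ := fun x => by linarith [(hb x).2]
  have hfin : ∀ x, fStar f a b (h x - (β - z₁)) ≠ ⊤ := fun x => fStar_ne_top_of_le ha0 (hle x) hz
  refine ⟨_, β - z₁, ⟨ae_of_all _ hfin, ?_⟩, rfl⟩
  refine Integrable.of_mem_Icc (α - (β - z₁)) (fStarR f a b z₁)
    ((measurable_fStarR ha0).comp (hh.sub_const _)).aemeasurable (ae_of_all _ fun x => ⟨?_, ?_⟩)
  · exact le_trans (by linarith [(hb x).1]) (le_fStarR ha1 hb1 hf1 (hfin x))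
  · exact fStarR_le_fStarR ha0 ha1 hb1 hf1 (hle x) hz

lemma le_of_mem_cgfValues (ha1 : a < 1) (hb1 : ((1 : ℝ) : EReal) < b) (hf1 : f 1 = 0)
    (hb : ∀ x, h x ∈ Icc α β) {r : ℝ} (hr : r ∈ cgfValues f a b P h) : α ≤ r := by
  obtain ⟨ν, ⟨hfin, h_int⟩, rfl⟩ := hr
  have : ∫ _, (α - ν) ∂P ≤ ∫ x, fStarR f a b (h x - ν) ∂P := by
    refine integral_mono_ae (integrable_const _) h_int ?_
    filter_upwards [hfin] with x hx
    exact le_trans (by linarith [(hb x).1]) (le_fStarR ha1 hb1 hf1 hx)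
  simp at this
  linarith

lemma cgfR_eq_sInf (ha0 : 0 ≤ a) (ha1 : a < 1) (hb1 : ((1 : ℝ) : EReal) < b) (hf1 : f 1 = 0)
    (hh : Measurable h) (hb : ∀ x, h x ∈ Icc α β) (hz : fStar f a b z₁ ≠ ⊤) :
    cgfR f a b P h = sInf (cgfValues f a b P h) := by
  obtain ⟨_, ν, hν, -⟩ := cgfValues_nonempty (P := P) ha0 ha1 hb1 hf1 hh hb hz
  exact toReal_iInf_add_ite ⟨ν, hν⟩
    fun ν hν => le_of_mem_cgfValues (P := P) (h := h) ha1 hb1 hf1 hb ⟨ν, hν, rfl⟩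

end

/-- The real values taken by the objective in the definition of `Λ_f` at a finite sample. -/
def lamValues (f : ℝ → ℝ) (a : ℝ) (b : EReal) {m : ℕ} (x : Fin m → ℝ) : Set ℝ :=
  {r | ∃ ν : ℝ, (∀ i, fStar f a b (x i - ν) ≠ ⊤) ∧
    r = ν + (m : ℝ)⁻¹ * ∑ i, fStarR f a b (x i - ν)}

/-- Real-valued version of `Λ_f` at a finite sample. -/
noncomputable def lamR (f : ℝ → ℝ) (a : ℝ) (b : EReal) {m : ℕ} (x : Fin m → ℝ) : ℝ := sInf (lamValues f a b x)

lemma cgfR_empMeas {X : Type*} [MeasurableSpace X] {h : X → ℝ} {α β z₁ : ℝ}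
    (ha0 : 0 ≤ a) (ha1 : a < 1) (hb1 : ((1 : ℝ) : EReal) < b) (hf1 : f 1 = 0)
    (hh : Measurable h) (hb : ∀ x, h x ∈ Icc α β) (hz : fStar f a b z₁ ≠ ⊤)
    {m : ℕ} (hm : 0 < m) (xs : Fin m → X) :
    cgfR f a b (empMeas m xs) h = lamR f a b fun i => h (xs i) := by
  have := isProbabilityMeasure_empMeas hm xs
  rw [cgfR_eq_sInf ha0 ha1 hb1 hf1 hh hb hz, lamR]
  congr 1
  ext r
  refine exists_congr fun ν => ?_
  have hmeas : Measurable fun x => fStarR f a b (h x - ν) :=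
    (measurable_fStarR ha0).comp (hh.sub_const _)
  have hset : MeasurableSet {x | fStar f a b (h x - ν) ≠ ⊤} :=
    ((measurable_fStar ha0).comp (hh.sub_const ν)) (measurableSet_singleton ⊤).compl
  rw [ae_empMeas_iff xs hset, integral_empMeas xs hmeas,
    and_iff_left (integrable_empMeas hm xs hmeas)]

section

variable {m : ℕ} {x : Fin m → ℝ} {α β z₁ : ℝ}

lemma le_of_mem_lamValues (ha1 : a < 1) (hb1 : ((1 : ℝ) : EReal) < b) (hf1 : f 1 = 0)
    (hm : 0 < m) (hx : ∀ i, α ≤ x i) {r : ℝ} (hr : r ∈ lamValues f a b x) : α ≤ r := by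
  obtain ⟨ν, hfin, rfl⟩ := hr
  have hm' : (0 : ℝ) < m := by exact_mod_cast hm
  have h1 : ∑ _i : Fin m, (α - ν) ≤ ∑ i, fStarR f a b (x i - ν) :=
    Finset.sum_le_sum fun i _ =>
      le_trans (by linarith [hx i]) (le_fStarR ha1 hb1 hf1 (hfin i))
  have h2 : (m : ℝ)⁻¹ * ∑ _i : Fin m, (α - ν) = α - ν := by
    rw [Finset.sum_const, Finset.card_univ, Fintype.card_fin, nsmul_eq_mul,
      inv_mul_cancel_left₀ hm'.ne']
  have h3 := mul_le_mul_of_nonneg_left h1 (inv_nonneg.2 hm'.le)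
  linarith

lemma bddBelow_lamValues (ha1 : a < 1) (hb1 : ((1 : ℝ) : EReal) < b) (hf1 : f 1 = 0)
    (hm : 0 < m) : BddBelow (lamValues f a b x) :=
  ⟨-‖x‖, fun _ hr => le_of_mem_lamValues ha1 hb1 hf1 hm
    (fun i => (abs_le.1 (norm_le_pi_norm x i)).1) hr⟩

lemma mem_lamValues_of_le (ha0 : 0 ≤ a) (hx : ∀ i, x i ≤ β) (hz : fStar f a b z₁ ≠ ⊤) :
    (β - z₁) + (m : ℝ)⁻¹ * ∑ i, fStarR f a b (x i - (β - z₁)) ∈ lamValues f a b x :=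
  ⟨β - z₁, fun i => fStar_ne_top_of_le ha0 (by linarith [hx i]) hz, rfl⟩

lemma lamValues_nonempty (ha0 : 0 ≤ a) (hz : fStar f a b z₁ ≠ ⊤) :
    (lamValues f a b x).Nonempty :=
  ⟨_, mem_lamValues_of_le ha0 (fun i => (abs_le.1 (norm_le_pi_norm x i)).2) hz⟩

lemma le_lamR (ha0 : 0 ≤ a) (ha1 : a < 1) (hb1 : ((1 : ℝ) : EReal) < b) (hf1 : f 1 = 0)
    (hm : 0 < m) (hz : fStar f a b z₁ ≠ ⊤) (hx : ∀ i, α ≤ x i) : α ≤ lamR f a b x :=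
  le_csInf (lamValues_nonempty ha0 hz) fun _ hr => le_of_mem_lamValues ha1 hb1 hf1 hm hx hr

lemma lamR_le (ha0 : 0 ≤ a) (ha1 : a < 1) (hb1 : ((1 : ℝ) : EReal) < b) (hf1 : f 1 = 0)
    (hm : 0 < m) (hz : fStar f a b z₁ ≠ ⊤) (hx : ∀ i, x i ≤ β) :
    lamR f a b x ≤ β - z₁ + fStarR f a b z₁ := by
  have hm' : (0 : ℝ) < m := by exact_mod_cast hm
  refine (csInf_le (bddBelow_lamValues ha1 hb1 hf1 hm) (mem_lamValues_of_le ha0 hx hz)).trans ?_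
  gcongr
  rw [inv_mul_le_iff₀ hm']
  calc ∑ i, fStarR f a b (x i - (β - z₁)) ≤ ∑ _i : Fin m, fStarR f a b z₁ :=
        Finset.sum_le_sum fun i _ =>
          fStarR_le_fStarR ha0 ha1 hb1 hf1 (by linarith [hx i]) hz
    _ = m * fStarR f a b z₁ := by simp

lemma lipschitzWith_lamR (ha0 : 0 ≤ a) (ha1 : a < 1) (hb1 : ((1 : ℝ) : EReal) < b) (hf1 : f 1 = 0)
    (hm : 0 < m) (hz : fStar f a b z₁ ≠ ⊤) :
    LipschitzWith 1 (lamR f a b : (Fin m → ℝ) → ℝ) := by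
  refine LipschitzWith.of_le_add fun x y => ?_
  rw [← sub_le_iff_le_add]
  refine le_csInf (lamValues_nonempty ha0 hz) ?_
  rintro _ ⟨ν, hν, rfl⟩
  have hle : ∀ i, x i - (ν + dist x y) ≤ y i - ν := fun i => by
    have := (le_abs_self _).trans (dist_le_pi_dist x y i)
    linarith
  have h1 : lamR f a b x ≤ _ := csInf_le (bddBelow_lamValues ha1 hb1 hf1 hm)
    ⟨ν + dist x y, fun i => fStar_ne_top_of_le ha0 (hle i) (hν i), rfl⟩
  have h2 : (m : ℝ)⁻¹ * ∑ i, fStarR f a b (x i - (ν + dist x y))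
      ≤ (m : ℝ)⁻¹ * ∑ i, fStarR f a b (y i - ν) := by
    gcongr with i
    exact fStarR_le_fStarR ha0 ha1 hb1 hf1 (hle i) (hν i)
  linarith

/-- Changing one entry of a sample in `[α, β]` moves `Λ_f` by at most the increment of `Λ_f`
between the constant sample `α` and the sample with one entry raised to `β`. -/
lemma lamR_sub_le (ha0 : 0 ≤ a) (ha1 : a < 1) (hb1 : ((1 : ℝ) : EReal) < b) (hf1 : f 1 = 0)
    {x y : Fin m → ℝ} (hx : ∀ i, x i ∈ Icc α β) (hy : ∀ i, y i ∈ Icc α β) {i : Fin m}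
    (hxy : ∀ j, j ≠ i → x j = y j) {z : ℝ} (hz : fStar f a b (β - α + z) ≠ ⊤) :
    lamR f a b x - lamR f a b y ≤
      -z + (m : ℝ)⁻¹ * ((m - 1) * fStarR f a b z + fStarR f a b (β - α + z)) := by
  have hm : 0 < m := i.pos
  have hm' : (0 : ℝ) < m := by exact_mod_cast hm
  have hαβ : α ≤ β := (hx i).1.trans (hx i).2
  have hz0 : fStar f a b z ≠ ⊤ := fStar_ne_top_of_le ha0 (by linarith) hz
  rw [sub_le_iff_le_add, add_comm, ← sub_le_iff_le_add]
  refine le_csInf (lamValues_nonempty ha0 hz) ?_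
  rintro _ ⟨ν, hν, rfl⟩
  rw [sub_le_iff_le_add]
  have hm1 : (m : ℝ) - 1 = ((Finset.univ.erase i).card : ℝ) := by
    rw [Finset.card_erase_of_mem (Finset.mem_univ i), Finset.card_univ, Fintype.card_fin,
      Nat.cast_sub hm, Nat.cast_one]
  have hsplit : ∀ g : Fin m → ℝ, ∑ j, g j = ∑ j ∈ Finset.univ.erase i, g j + g i := fun g =>
    (Finset.sum_erase_add _ _ (Finset.mem_univ i)).symm
  have hν' : ∀ j, fStar f a b (α - ν) ≠ ⊤ := fun j =>
    fStar_ne_top_of_le ha0 (by linarith [(hy j).1]) (hν j)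
  rcases le_total (α - z) ν with hle | hle
  · have hxν : ∀ j, fStar f a b (x j - ν) ≠ ⊤ := fun j =>
      fStar_ne_top_of_le ha0 (by linarith [(hx j).2]) hz
    have h1 : lamR f a b x ≤ _ := csInf_le (bddBelow_lamValues ha1 hb1 hf1 hm) ⟨ν, hxν, rfl⟩
    have h2 : ∑ j ∈ Finset.univ.erase i, fStarR f a b (x j - ν)
        = ∑ j ∈ Finset.univ.erase i, fStarR f a b (y j - ν) :=
      Finset.sum_congr rfl fun j hj => by rw [hxy j (Finset.ne_of_mem_erase hj)]
    have h3 : fStarR f a b (x i - ν) + fStarR f a b z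
        ≤ fStarR f a b (y i - ν) + fStarR f a b (β - α + z) := by
      have h4 := fStarR_add_le ha0 ha1 hb1 hf1 (p := α - ν) (q := z) (d := β - α)
        (by linarith) (by linarith) (by rwa [add_comm])
      have h5 : fStarR f a b (x i - ν) ≤ fStarR f a b (α - ν + (β - α)) :=
        fStarR_le_fStarR ha0 ha1 hb1 hf1 (by linarith [(hx i).2])
          (fStar_ne_top_of_le ha0 (by linarith) hz)
      have h6 : fStarR f a b (α - ν) ≤ fStarR f a b (y i - ν) :=
        fStarR_le_fStarR ha0 ha1 hb1 hf1 (by linarith [(hy i).1]) (hν i)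
      rw [add_comm z] at h4
      linarith
    have h7 := le_fStarR ha1 hb1 hf1 hz0
    rw [hsplit, h2] at h1
    rw [hsplit]
    have h8 : (m : ℝ)⁻¹ * (fStarR f a b (x i - ν) + fStarR f a b z)
        ≤ (m : ℝ)⁻¹ * (fStarR f a b (y i - ν) + fStarR f a b (β - α + z)) := by gcongr
    have h9 : (m : ℝ)⁻¹ * ((m - 1) * fStarR f a b z + fStarR f a b (β - α + z))
        = fStarR f a b z - (m : ℝ)⁻¹ * fStarR f a b z + (m : ℝ)⁻¹ * fStarR f a b (β - α + z) := by
      field_simp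
    rw [h9]
    simp only [mul_add] at h1 h8 ⊢
    linarith
  · have hxz : ∀ j, x j - (α - z) ≤ β - α + z := fun j => by linarith [(hx j).2]
    have hxν : ∀ j, fStar f a b (x j - (α - z)) ≠ ⊤ := fun j => fStar_ne_top_of_le ha0 (hxz j) hz
    have h1 : lamR f a b x ≤ _ := csInf_le (bddBelow_lamValues ha1 hb1 hf1 hm) ⟨α - z, hxν, rfl⟩
    have h2 : ∑ j ∈ Finset.univ.erase i, (fStarR f a b (x j - (α - z)) + fStarR f a b (α - ν))
        ≤ ∑ j ∈ Finset.univ.erase i, (fStarR f a b (y j - ν) + fStarR f a b z) := by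
      refine Finset.sum_le_sum fun j hj => ?_
      rw [hxy j (Finset.ne_of_mem_erase hj)]
      have h4 := fStarR_add_le ha0 ha1 hb1 hf1 (p := z) (q := α - ν) (d := y j - α)
        (by linarith) (by linarith [(hy j).1]) (by convert hν j using 2; ring)
      have e1 : z + (y j - α) = y j - (α - z) := by ring
      have e2 : α - ν + (y j - α) = y j - ν := by ring
      rw [e1, e2] at h4
      linarith
    have h3 : fStarR f a b (x i - (α - z)) ≤ fStarR f a b (β - α + z) :=
      fStarR_le_fStarR ha0 ha1 hb1 hf1 (hxz i) hz
    have h6 : fStarR f a b (α - ν) ≤ fStarR f a b (y i - ν) :=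
      fStarR_le_fStarR ha0 ha1 hb1 hf1 (by linarith [(hy i).1]) (hν i)
    have h7 := le_fStarR ha1 hb1 hf1 (hν' i)
    rw [Finset.sum_add_distrib, Finset.sum_add_distrib, Finset.sum_const, Finset.sum_const,
      nsmul_eq_mul, nsmul_eq_mul, ← hm1] at h2
    rw [hsplit] at h1
    rw [hsplit]
    have h8 : (m : ℝ)⁻¹ * (∑ j ∈ Finset.univ.erase i, fStarR f a b (x j - (α - z))
          + fStarR f a b (x i - (α - z)) + m * fStarR f a b (α - ν))
        ≤ (m : ℝ)⁻¹ * (∑ j ∈ Finset.univ.erase i, fStarR f a b (y j - ν) + fStarR f a b (y i - ν)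
          + ((m - 1) * fStarR f a b z + fStarR f a b (β - α + z))) := by
      gcongr ?_ * ?_
      linarith
    have h9 : (m : ℝ)⁻¹ * (m * fStarR f a b (α - ν)) = fStarR f a b (α - ν) := by
      field_simp
    simp only [mul_add] at h1 h8 h9 ⊢
    linarith

end

end Cumulant

section EmpiricalDivergence

variable {X : Type*} {f : ℝ → ℝ} {a : ℝ} {b : EReal}

lemma mean_mem_Icc {k : ℕ} (hk : 0 < k) {y : Fin k → ℝ} {α β : ℝ} (hy : ∀ i, y i ∈ Icc α β) :
    (k : ℝ)⁻¹ * ∑ i, y i ∈ Icc α β := by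
  have hk' : (0 : ℝ) < k := by exact_mod_cast hk
  constructor
  · rw [le_inv_mul_iff₀ hk']
    simpa using Finset.card_nsmul_le_sum Finset.univ y α fun i _ => (hy i).1
  · rw [inv_mul_le_iff₀ hk']
    simpa using Finset.sum_le_card_nsmul Finset.univ y β fun i _ => (hy i).2

lemma mean_sub_le {k : ℕ} {y y' : Fin k → ℝ} {α β : ℝ} (hy : ∀ i, y i ∈ Icc α β)
    (hy' : ∀ i, y' i ∈ Icc α β) {i : Fin k} (h : ∀ j, j ≠ i → y j = y' j) :
    (k : ℝ)⁻¹ * ∑ j, y j - (k : ℝ)⁻¹ * ∑ j, y' j ≤ (k : ℝ)⁻¹ * (β - α) := by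
  rw [← mul_sub, ← Finset.sum_sub_distrib,
    Finset.sum_eq_single i (fun j _ hj => by rw [h j hj, sub_self]) (by simp)]
  have h1 := (hy i).2
  have h2 := (hy' i).1
  gcongr

/-- The objective of the `(f,Γ)`-divergence between two empirical measures. -/
noncomputable def empObj (f : ℝ → ℝ) (a : ℝ) (b : EReal) {n m : ℕ} (h : X → ℝ)
    (p : (Fin n → X) × (Fin m → X)) : ℝ :=
  (n : ℝ)⁻¹ * ∑ i, h (p.1 i) - lamR f a b fun j => h (p.2 j)

lemma abs_empObj_le {h : X → ℝ} {α β z₁ : ℝ}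
    (ha0 : 0 ≤ a) (ha1 : a < 1) (hb1 : ((1 : ℝ) : EReal) < b) (hf1 : f 1 = 0)
    (hb : ∀ x, h x ∈ Icc α β) (hz : fStar f a b z₁ ≠ ⊤) {n m : ℕ} (hn : 0 < n) (hm : 0 < m)
    (p : (Fin n → X) × (Fin m → X)) :
    |empObj f a b h p| ≤ |β - α| + |β - z₁ + fStarR f a b z₁ - α| := by
  obtain ⟨h1, h2⟩ := mean_mem_Icc hn fun i => hb (p.1 i)
  have h3 := le_lamR ha0 ha1 hb1 hf1 hm hz fun j => (hb (p.2 j)).1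
  have h4 := lamR_le ha0 ha1 hb1 hf1 hm hz fun j => (hb (p.2 j)).2
  have h5 := le_abs_self (β - α)
  have h6 := le_abs_self (β - z₁ + fStarR f a b z₁ - α)
  have h7 := abs_nonneg (β - α)
  have h8 := abs_nonneg (β - z₁ + fStarR f a b z₁ - α)
  rw [empObj, abs_le]
  constructor <;> linarith

/-- The supremum defining the empirical divergence may be taken over a pointwise dense subset. -/
lemma iSup_empObj_eq_of_dense {Γ Γ₀ : Set (X → ℝ)} (hne : Γ.Nonempty) (hsub : Γ₀ ⊆ Γ)
    (hdense : ∀ h ∈ Γ, ∃ s : ℕ → X → ℝ,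
      (∀ j, s j ∈ Γ₀) ∧ ∀ x, Tendsto (fun j => s j x) atTop (𝓝 (h x)))
    {n m : ℕ} (hcont : Continuous (lamR f a b : (Fin m → ℝ) → ℝ))
    {p : (Fin n → X) × (Fin m → X)} (hbdd : BddAbove (range fun h : Γ => empObj f a b h.1 p)) :
    ⨆ h : Γ, empObj f a b h.1 p = ⨆ h : Γ₀, empObj f a b h.1 p := by
  have hbdd₀ : BddAbove (range fun h : Γ₀ => empObj f a b h.1 p) :=
    hbdd.mono (by rintro _ ⟨h, rfl⟩; exact ⟨⟨h.1, hsub h.2⟩, rfl⟩)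
  have : Nonempty Γ := hne.to_subtype
  have : Nonempty Γ₀ :=
    let ⟨h, hh⟩ := hne
    let ⟨s, hs, _⟩ := hdense h hh
    ⟨⟨s 0, hs 0⟩⟩
  refine le_antisymm (ciSup_le fun h => ?_)
    (ciSup_le fun h => le_ciSup hbdd ⟨h.1, hsub h.2⟩)
  obtain ⟨s, hs, hlim⟩ := hdense h.1 h.2
  refine le_of_tendsto (f := fun k => empObj f a b (s k) p) (x := atTop) ?_
    (Eventually.of_forall fun k => le_ciSup hbdd₀ ⟨s k, hs k⟩)
  exact ((tendsto_finsetSum _ fun i _ => hlim (p.1 i)).const_mul _).sub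
    ((hcont.tendsto _).comp (tendsto_pi_nhds.2 fun j => hlim (p.2 j)))

lemma ciSup_sub_ciSup_le {ι : Type*} [Nonempty ι] {u v : ι → ℝ} {c : ℝ}
    (hv : BddAbove (range v)) (h : ∀ i, u i - v i ≤ c) : (⨆ i, u i) - ⨆ i, v i ≤ c := by
  rw [sub_le_iff_le_add]
  exact ciSup_le fun i => by linarith [h i, le_ciSup hv i]

variable [MeasurableSpace X]

lemma integral_pi_mean {μ : Measure X} [IsProbabilityMeasure μ] {k : ℕ} (hk : 0 < k)
    {g : X → ℝ} (hg : Integrable g μ) :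
    Integrable (fun x : Fin k → X => (k : ℝ)⁻¹ * ∑ i, g (x i)) (Measure.pi fun _ => μ) ∧
    ∫ x : Fin k → X, (k : ℝ)⁻¹ * ∑ i, g (x i) ∂(Measure.pi fun _ => μ) = ∫ x, g x ∂μ := by
  have h_int : ∀ i : Fin k, Integrable (fun x : Fin k → X => g (x i)) (Measure.pi fun _ => μ) :=
    fun i => integrable_comp_eval (μ := fun _ : Fin k => μ) hg
  refine ⟨(integrable_finsetSum _ fun i _ => h_int i).const_mul _, ?_⟩
  have hk' : (k : ℝ) ≠ 0 := by exact_mod_cast hk.ne'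
  rw [integral_const_mul, integral_finsetSum _ fun i _ => h_int i]
  have : ∀ i : Fin k, ∫ x : Fin k → X, g (x i) ∂(Measure.pi fun _ => μ) = ∫ x, g x ∂μ :=
    fun i => integral_comp_eval (μ := fun _ : Fin k => μ) hg.aestronglyMeasurable
  simp only [this]
  rw [Finset.sum_const, Finset.card_univ, Fintype.card_fin, nsmul_eq_mul, inv_mul_cancel_left₀ hk']

/-- `Λ_f` at an i.i.d. sample is, in expectation, at most the population value. -/
lemma integral_lamR_le {P : Measure X} [IsProbabilityMeasure P] {h : X → ℝ} {α β z₁ : ℝ}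
    (ha0 : 0 ≤ a) (ha1 : a < 1) (hb1 : ((1 : ℝ) : EReal) < b) (hf1 : f 1 = 0)
    (hh : Measurable h) (hb : ∀ x, h x ∈ Icc α β) (hz : fStar f a b z₁ ≠ ⊤)
    {m : ℕ} (hm : 0 < m)
    (h_int : Integrable (fun x : Fin m → X => lamR f a b fun j => h (x j))
      (Measure.pi fun _ => P)) :
    ∫ x : Fin m → X, lamR f a b (fun j => h (x j)) ∂(Measure.pi fun _ => P)
      ≤ cgfR f a b P h := by
  rw [cgfR_eq_sInf ha0 ha1 hb1 hf1 hh hb hz]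
  refine le_csInf (cgfValues_nonempty ha0 ha1 hb1 hf1 hh hb hz) ?_
  rintro _ ⟨ν, ⟨hfin, hν⟩, rfl⟩
  obtain ⟨h1, h2⟩ := integral_pi_mean hm hν
  have h3 : ∫ x : Fin m → X, (ν + (m : ℝ)⁻¹ * ∑ j, fStarR f a b (h (x j) - ν))
      ∂(Measure.pi fun _ => P) = ν + ∫ x, fStarR f a b (h x - ν) ∂P := by
    rw [integral_add (integrable_const _) h1, h2]
    simp
  rw [← h3]
  refine integral_mono_ae h_int ((integrable_const _).add h1) ?_
  have h4 : ∀ᵐ x ∂(Measure.pi fun _ : Fin m => P), ∀ j, fStar f a b (h (x j) - ν) ≠ ⊤ :=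
    ae_all_iff.2 fun j =>
      (measurePreserving_eval (fun _ : Fin m => P) j).quasiMeasurePreserving.ae hfin
  filter_upwards [h4] with x hx
  exact csInf_le (bddBelow_lamValues ha1 hb1 hf1 hm) ⟨ν, hx, rfl⟩

lemma measurable_empObj {h : X → ℝ} {z₁ : ℝ}
    (ha0 : 0 ≤ a) (ha1 : a < 1) (hb1 : ((1 : ℝ) : EReal) < b) (hf1 : f 1 = 0)
    (hh : Measurable h) (hz : fStar f a b z₁ ≠ ⊤) {n m : ℕ} (hm : 0 < m) :
    Measurable (empObj f a b h : (Fin n → X) × (Fin m → X) → ℝ) := by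
  have h1 : Measurable fun p : (Fin n → X) × (Fin m → X) => lamR f a b fun j => h (p.2 j) :=
    (lipschitzWith_lamR ha0 ha1 hb1 hf1 hm hz).continuous.measurable.comp (by fun_prop)
  exact Measurable.sub (by fun_prop) h1

lemma Dfg_empMeas {Γ : Set (X → ℝ)} {α β z₁ : ℝ}
    (ha0 : 0 ≤ a) (ha1 : a < 1) (hb1 : ((1 : ℝ) : EReal) < b) (hf1 : f 1 = 0)
    (hmeas : ∀ h ∈ Γ, Measurable h) (hbd : ∀ h ∈ Γ, ∀ x, h x ∈ Icc α β)
    (hz : fStar f a b z₁ ≠ ⊤) {n m : ℕ} (hm : 0 < m) (p : (Fin n → X) × (Fin m → X)) :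
    Dfg f a b Γ (empMeas n p.1) (empMeas m p.2) = ⨆ h : Γ, empObj f a b h.1 p := by
  rw [Dfg, iSup]
  congr 1
  ext r
  simp only [mem_ofPred_eq, mem_range, Subtype.exists, exists_prop]
  refine exists_congr fun h => and_congr_right fun hh => ?_
  rw [integral_empMeas _ (hmeas h hh),
    cgfR_empMeas ha0 ha1 hb1 hf1 (hmeas h hh) (hbd h hh) hz hm, empObj, eq_comm]

/-- Concentration of the empirical divergence about its mean, when changing one entry of the second
sample moves `Λ_f` by at most `c`. -/
lemma hasSubgaussianMGF_iSup_empObj {ι : Type*} [Nonempty ι] {h : ι → X → ℝ} {α β C c : ℝ}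
    (Q P : Measure X) [IsProbabilityMeasure Q] [IsProbabilityMeasure P] {n m : ℕ}
    (hbd : ∀ i x, h i x ∈ Icc α β)
    (hmeas : Measurable fun p : (Fin n → X) × (Fin m → X) => ⨆ i, empObj f a b (h i) p)
    (hC : ∀ i (p : (Fin n → X) × (Fin m → X)), |empObj f a b (h i) p| ≤ C)
    (hc : ∀ (x y : Fin m → ℝ) (j : Fin m), (∀ k, x k ∈ Icc α β) → (∀ k, y k ∈ Icc α β) →
      (∀ k, k ≠ j → x k = y k) → lamR f a b x - lamR f a b y ≤ c) :
    ProbabilityTheory.HasSubgaussianMGF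
      (fun p : (Fin n → X) × (Fin m → X) => (⨆ i, empObj f a b (h i) p)
        - ∫ p : (Fin n → X) × (Fin m → X), (⨆ i, empObj f a b (h i) p)
          ∂((Measure.pi fun _ : Fin n => Q).prod (Measure.pi fun _ : Fin m => P)))
      (n * (‖(n : ℝ)⁻¹ * (β - α)‖₊ / 2) ^ 2 + m * (‖c‖₊ / 2) ^ 2)
      ((Measure.pi fun _ : Fin n => Q).prod (Measure.pi fun _ : Fin m => P)) := by
  have hbdd : ∀ p : (Fin n → X) × (Fin m → X), BddAbove (range fun i => empObj f a b (h i) p) :=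
    fun p => ⟨C, by rintro _ ⟨i, rfl⟩; exact (abs_le.1 (hC i p)).2⟩
  set G : (Fin n → X) × (Fin m → X) → ℝ := fun p => ⨆ i, empObj f a b (h i) p with hG
  have hGC : ∀ p, |G p| ≤ C := by
    intro p
    refine abs_le.2 ⟨?_, ciSup_le fun i => (abs_le.1 (hC i p)).2⟩
    obtain ⟨i⟩ := ‹Nonempty ι›
    exact (abs_le.1 (hC i p)).1.trans (le_ciSup (hbdd p) i)
  have h_int : ∀ y, Integrable (fun x => G (x, y)) (Measure.pi fun _ : Fin n => Q) := fun y =>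
    Integrable.of_bound (hmeas.comp (by fun_prop)).aestronglyMeasurable C
      (ae_of_all _ fun x => hGC _)
  have hintG : Integrable G
      ((Measure.pi fun _ : Fin n => Q).prod (Measure.pi fun _ : Fin m => P)) :=
    Integrable.of_bound hmeas.aestronglyMeasurable C (ae_of_all _ hGC)
  refine hasSubgaussianMGF_prod hmeas hGC (fun y => ?_) ?_
  · refine hasSubgaussianMGF_of_bounded_differences Q C n _ (hmeas.comp (by fun_prop))
      (fun x => hGC _) fun i x x' hxx => ?_
    refine ciSup_sub_ciSup_le (hbdd _) fun k => ?_
    have := mean_sub_le (fun i => hbd k (x i)) (fun i => hbd k (x' i)) (i := i)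
      fun j hj => congrArg (h k) (hxx j hj)
    simp only [empObj]
    linarith
  · rw [integral_prod_symm _ hintG]
    refine hasSubgaussianMGF_of_bounded_differences P C m _
      (hmeas.stronglyMeasurable.integral_prod_left').measurable (fun y => ?_)
      fun j y y' hyy => ?_
    · simpa using norm_integral_le_of_norm_le_const
        (μ := Measure.pi fun _ : Fin n => Q) (f := fun x => G (x, y)) (C := C)
        (ae_of_all _ fun x => hGC _)
    · rw [← integral_sub (h_int y) (h_int y')]
      calc ∫ x, (G (x, y) - G (x, y')) ∂(Measure.pi fun _ : Fin n => Q)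
          ≤ ∫ _, c ∂(Measure.pi fun _ : Fin n => Q) := by
            refine integral_mono ((h_int y).sub (h_int y')) (integrable_const _) fun x => ?_
            refine ciSup_sub_ciSup_le (hbdd _) fun k => ?_
            have := hc (fun j => h k (y' j)) (fun j => h k (y j)) j (fun _ => hbd k _)
              (fun _ => hbd k _) fun i hi => congrArg (h k) (hyy i hi).symm
            simp only [empObj]
            linarith
        _ = c := by simp

end EmpiricalDivergence

open MeasureTheory in
/-- Concentration inequality for estimation of the
`(f,Γ)`-divergence (lower deviation). -/
theorem stmt15 {X : Type*} [MeasurableSpace X]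
    (Γ : Set (X → ℝ)) (hΓne : Γ.Nonempty)
    (hmeas : ∀ h ∈ Γ, Measurable h) (α β : ℝ) (hαβ : α < β)
    (hbd : ∀ h ∈ Γ, ∀ x, h x ∈ Set.Icc α β)
    (hΓd : PtwiseDenseCount Γ)
    (f : ℝ → ℝ) (a : ℝ) (b : EReal)
    (ha0 : 0 ≤ a) (ha1 : a < 1) (hb1 : ((1 : ℝ) : EReal) < b)
    (hconv : ConvexOn ℝ (Dom a b) f) (hf1 : f 1 = 0)
    (hstrict : ∃ ε > 0, Set.Ioo (1 - ε) (1 + ε) ⊆ Dom a b ∧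
      StrictConvexOn ℝ (Set.Ioo (1 - ε) (1 + ε)) f)
    (hz : zz f + β - α ∈ interior {z : ℝ | fStar f a b z < ⊤})
    (Q P : Measure X) [IsProbabilityMeasure Q] [IsProbabilityMeasure P]
    {Ω : Type*} [MeasurableSpace Ω] (ℙ : Measure Ω) [IsProbabilityMeasure ℙ]
    (n m : ℕ) (hn : 0 < n) (hm : 0 < m)
    (Xs : Fin n → Ω → X) (Xs' : Fin m → Ω → X)
    (hXm : ∀ i, Measurable (Xs i)) (hX'm : ∀ j, Measurable (Xs' j))
    (hlaw : Measure.map (fun ω => (fun i => Xs i ω, fun j => Xs' j ω)) ℙ =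
      (Measure.pi fun _ : Fin n => Q).prod (Measure.pi fun _ : Fin m => P))
    (ε : ℝ) (hε : 0 < ε) :
    (ℙ {ω | Dfg f a b Γ Q P
          - Dfg f a b Γ (empMeas n fun i => Xs i ω) (empMeas m fun j => Xs' j ω)
        ≥ ε}).toReal ≤
      Real.exp (-(2 * ε ^ 2) /
        ((1 / (n : ℝ)) * (β - α) ^ 2 + (1 / (m : ℝ)) * (Δq f a b α β m) ^ 2)) := by
  have hz1 : fStar f a b (zz f + β - α) ≠ ⊤ := by
    have := interior_subset hz
    rw [mem_ofPred_eq] at this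
    exact this.ne
  obtain ⟨Γ₀, hsub, hcount, hdense⟩ := hΓd
  have : Nonempty Γ := hΓne.to_subtype
  have : Countable Γ₀ := hcount.to_subtype
  have hm' : (0 : ℝ) < m := by exact_mod_cast hm
  have hn' : (0 : ℝ) < n := by exact_mod_cast hn
  set C := |β - α| + |β - (zz f + β - α) + fStarR f a b (zz f + β - α) - α|
  have hC : ∀ (h : Γ) (p : (Fin n → X) × (Fin m → X)), |empObj f a b h.1 p| ≤ C :=
    fun h p => abs_empObj_le ha0 ha1 hb1 hf1 (hbd h.1 h.2) hz1 hn hm p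
  have hbdd : ∀ p : (Fin n → X) × (Fin m → X),
      BddAbove (range fun h : Γ => empObj f a b h.1 p) :=
    fun p => ⟨C, by rintro _ ⟨h, rfl⟩; exact (abs_le.1 (hC h p)).2⟩
  set G : (Fin n → X) × (Fin m → X) → ℝ := fun p => ⨆ h : Γ, empObj f a b h.1 p with hG
  have hGmeas : Measurable G := by
    have hG₀ : G = fun p => ⨆ h : Γ₀, empObj f a b h.1 p := funext fun p =>
      iSup_empObj_eq_of_dense hΓne hsub hdense
        (lipschitzWith_lamR ha0 ha1 hb1 hf1 hm hz1).continuous (hbdd p)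
    rw [hG₀]
    exact Measurable.iSup fun h =>
      measurable_empObj ha0 ha1 hb1 hf1 (hmeas h.1 (hsub h.2)) hz1 hm
  have hlam : ∀ (x y : Fin m → ℝ) (j : Fin m), (∀ k, x k ∈ Icc α β) → (∀ k, y k ∈ Icc α β) →
      (∀ k, k ≠ j → x k = y k) → lamR f a b x - lamR f a b y ≤ (m : ℝ)⁻¹ * Δq f a b α β m := by
    intro x y j hx hy hxy
    rw [le_inv_mul_iff₀ hm']
    refine le_csInf ((nonempty_Icc.2 (by linarith)).image _) ?_
    rintro _ ⟨z, hz, rfl⟩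
    have h1 := lamR_sub_le ha0 ha1 hb1 hf1 hx hy hxy (z := z)
      (fStar_ne_top_of_le ha0 (by linarith [hz.2]) hz1)
    refine mul_le_mul_of_nonneg_left (h1.trans_eq ?_) hm'.le
    field_simp
    ring
  set μ := (Measure.pi fun _ : Fin n => Q).prod (Measure.pi fun _ : Fin m => P) with hμ
  have hsg := hasSubgaussianMGF_iSup_empObj (h := fun h : Γ => h.1) Q P
    (fun h x => hbd h.1 h.2 x) hGmeas hC hlam
  have hGint : Integrable G μ := hsg.integrable.congr (ae_of_all _ fun _ => rfl) |>.add
    (integrable_const (∫ p, G p ∂μ)) |>.congr (ae_of_all _ fun p => by simp [hG, hμ])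
  have hmean : Dfg f a b Γ Q P ≤ ∫ p, G p ∂μ := by
    refine csSup_le (let ⟨h, hh⟩ := hΓne; ⟨_, h, hh, rfl⟩) ?_
    rintro _ ⟨h, hh, rfl⟩
    have hintQ : Integrable h Q :=
      Integrable.of_mem_Icc α β (hmeas h hh).aemeasurable (ae_of_all _ (hbd h hh))
    obtain ⟨h1, h2⟩ := integral_pi_mean hn hintQ
    have hlamint : Integrable (fun x : Fin m → X => lamR f a b fun j => h (x j))
        (Measure.pi fun _ => P) := by
      have hmh := hmeas h hh
      refine Integrable.of_mem_Icc α
        (β - (zz f + β - α) + fStarR f a b (zz f + β - α))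
        ((lipschitzWith_lamR ha0 ha1 hb1 hf1 hm hz1).continuous.measurable.comp
          (by fun_prop)).aemeasurable (ae_of_all _ fun x => ⟨?_, ?_⟩)
      · exact le_lamR ha0 ha1 hb1 hf1 hm hz1 fun j => (hbd h hh _).1
      · exact lamR_le ha0 ha1 hb1 hf1 hm hz1 fun j => (hbd h hh _).2
    have h3 := integral_lamR_le ha0 ha1 hb1 hf1 (hmeas h hh) (hbd h hh) hz1 hm hlamint
    have h4 : Integrable (empObj f a b h : (Fin n → X) × (Fin m → X) → ℝ) μ :=
      (h1.comp_fst _).sub (hlamint.comp_snd _)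
    have h5 : ∫ p, empObj f a b h p ∂μ = ∫ x, h x ∂Q
        - ∫ x : Fin m → X, lamR f a b (fun j => h (x j)) ∂(Measure.pi fun _ => P) := by
      simp only [empObj]
      rw [integral_sub (h1.comp_fst _) (hlamint.comp_snd _), integral_fun_fst
        (f := fun x : Fin n → X => (n : ℝ)⁻¹ * ∑ i, h (x i)), integral_fun_snd
        (f := fun x : Fin m → X => lamR f a b fun j => h (x j)), h2]
      simp
    have h6 : ∫ p, empObj f a b h p ∂μ ≤ ∫ p, G p ∂μ :=
      integral_mono h4 hGint fun p => le_ciSup (hbdd p) ⟨h, hh⟩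
    linarith
  set T : Ω → (Fin n → X) × (Fin m → X) := fun ω => (fun i => Xs i ω, fun j => Xs' j ω) with hT
  have hTm : Measurable T := by fun_prop
  have hset : {ω | Dfg f a b Γ Q P
      - Dfg f a b Γ (empMeas n fun i => Xs i ω) (empMeas m fun j => Xs' j ω) ≥ ε}
      ⊆ T ⁻¹' {p | ε ≤ -(G p - ∫ p, G p ∂μ)} := by
    intro ω hω
    have h1 := Dfg_empMeas ha0 ha1 hb1 hf1 hmeas hbd hz1 hm (T ω)
    simp only [mem_ofPred_eq, mem_preimage, hT, hG] at hω h1 ⊢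
    linarith
  have hSm : MeasurableSet {p | ε ≤ -(G p - ∫ p, G p ∂μ)} :=
    measurableSet_le measurable_const (hGmeas.sub_const _).neg
  calc (ℙ {ω | Dfg f a b Γ Q P
      - Dfg f a b Γ (empMeas n fun i => Xs i ω) (empMeas m fun j => Xs' j ω) ≥ ε}).toReal
      ≤ ℙ.real (T ⁻¹' {p | ε ≤ -(G p - ∫ p, G p ∂μ)}) := measureReal_mono hset
    _ = μ.real {p | ε ≤ -(G p - ∫ p, G p ∂μ)} := by
      rw [← map_measureReal_apply hTm hSm, hlaw]
    _ ≤ _ := hsg.neg.measure_ge_le hε.le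
    _ = _ := by
      congr 1
      push_cast
      simp only [Real.norm_eq_abs, div_pow, sq_abs]
      field_simp
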